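/- arXiv:1505.07935 — 2 statements merged into one kernel-verified Lean document; each statement's English description precedes it below -/
import Mathlib

section
/- For 0 < θ < 1 define the lens map λ_θ(z) = ((1+z)^θ − (1−z)^θ)/((1+z)^θ + (1−z)^θ), using principal-branch complex powers. Then for all θ, θ' ∈ (0,1): (i) λ_θ maps the open unit disk 𝔻 into 𝔻, and (ii) for every z ∈ 𝔻, λ_θ(λ_{θ'}(z)) = λ_{θθ'}(z), i.e. the lens maps form a semigroup: λ_θ ∘ λ_{θ'} = λ_{θθ'}. -/
noncomputable section

/-- The lens map of parameter `θ`, with principal-branch complex powers. -/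
def lensMap (θ : ℝ) (z : ℂ) : ℂ :=
  ((1 + z) ^ (θ : ℂ) - (1 - z) ^ (θ : ℂ)) / ((1 + z) ^ (θ : ℂ) + (1 - z) ^ (θ : ℂ))

theorem lens_log_im {a : ℂ} (ha : 0 < a.re) : |(Complex.log a).im| < Real.pi / 2 := by
  rw [Complex.log_im, Complex.abs_arg_lt_pi_div_two_iff]
  exact Or.inl ha

theorem lens_ne {a : ℂ} (ha : 0 < a.re) : a ≠ 0 := by
  rintro rfl
  simp at ha

theorem lens_div_cpow {a b : ℂ} (ha : 0 < a.re) (hb : 0 < b.re) (t : ℂ) :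
    (a / b) ^ t = a ^ t / b ^ t := by
  have h1 := abs_lt.1 (lens_log_im ha)
  have h2 := abs_lt.1 (lens_log_im hb)
  have h : Complex.log (a / b) = Complex.log a - Complex.log b := by
    rw [← Complex.log_exp (x := Complex.log a - Complex.log b), Complex.exp_sub,
      Complex.exp_log (lens_ne ha), Complex.exp_log (lens_ne hb)]
    · rw [Complex.sub_im]; linarith
    · rw [Complex.sub_im]; linarith
  rw [Complex.cpow_def_of_ne_zero (div_ne_zero (lens_ne ha) (lens_ne hb)),
    Complex.cpow_def_of_ne_zero (lens_ne ha), Complex.cpow_def_of_ne_zero (lens_ne hb), h,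
    sub_mul, Complex.exp_sub]

theorem lens_cpow_im {a : ℂ} (ha : 0 < a.re) {t : ℝ} (h0 : 0 < t) (h1 : t < 1) :
    |(Complex.log a * t).im| < Real.pi / 2 := by
  rw [Complex.im_mul_ofReal, abs_mul, abs_of_pos h0]
  have := lens_log_im ha
  nlinarith [abs_nonneg (Complex.log a).im]

theorem lens_cpow_re {a : ℂ} (ha : 0 < a.re) {t : ℝ} (h0 : 0 < t) (h1 : t < 1) :
    0 < (a ^ (t : ℂ)).re := by
  rw [Complex.cpow_def_of_ne_zero (lens_ne ha), Complex.exp_re]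
  have := abs_lt.1 (lens_cpow_im ha h0 h1)
  exact mul_pos (Real.exp_pos _) (Real.cos_pos_of_mem_Ioo ⟨by linarith, this.2⟩)

theorem lens_disk {z : ℂ} (hz : z ∈ Metric.ball (0 : ℂ) 1) :
    0 < (1 + z).re ∧ 0 < (1 - z).re ∧ 0 < ((1 + z) / (1 - z)).re := by
  have hz' : ‖z‖ < 1 := by simpa using hz
  have h := abs_lt.1 ((Complex.abs_re_le_norm z).trans_lt hz')
  have hb : 0 < (1 - z).re := by simp; linarith
  refine ⟨by simp; linarith, hb, ?_⟩
  have hn : 0 < Complex.normSq (1 - z) := Complex.normSq_pos.2 (lens_ne hb)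
  have hs : Complex.normSq z < 1 := by
    rw [Complex.normSq_eq_norm_sq]; nlinarith [norm_nonneg z]
  rw [Complex.normSq_apply] at hs
  rw [Complex.div_re, ← add_div]
  apply div_pos _ hn
  simp
  nlinarith

theorem lens_eq {z : ℂ} (hz : z ∈ Metric.ball (0 : ℂ) 1) (t : ℝ) :
    lensMap t z = (((1 + z) / (1 - z)) ^ (t : ℂ) - 1) / (((1 + z) / (1 - z)) ^ (t : ℂ) + 1) := by
  obtain ⟨h1, h2, -⟩ := lens_disk hz
  have hb : (1 - z) ^ (t : ℂ) ≠ 0 := by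
    rw [Complex.cpow_def_of_ne_zero (lens_ne h2)]; exact Complex.exp_ne_zero _
  rw [lens_div_cpow h1 h2, lensMap, div_sub_one hb, div_add_one hb, div_div_div_cancel_right₀ hb]

theorem lens_mapsTo {t : ℝ} (h0 : 0 < t) (h1 : t < 1) :
    Set.MapsTo (lensMap t) (Metric.ball (0 : ℂ) 1) (Metric.ball (0 : ℂ) 1) := by
  intro z hz
  have hw := lens_cpow_re (lens_disk hz).2.2 h0 h1
  rw [lens_eq hz]
  set w := ((1 + z) / (1 - z)) ^ (t : ℂ)
  have hne : w + 1 ≠ 0 := lens_ne (by simp; linarith)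
  rw [mem_ball_zero_iff, norm_div, div_lt_one (norm_pos_iff.2 hne)]
  apply lt_of_pow_lt_pow_left₀ 2 (norm_nonneg _)
  rw [← Complex.normSq_eq_norm_sq, ← Complex.normSq_eq_norm_sq, Complex.normSq_apply,
    Complex.normSq_apply]
  simp
  nlinarith

/-- The lens maps send the unit disk into itself and form a semigroup:
`λ_θ ∘ λ_{θ'} = λ_{θθ'}` on `𝔻`. -/
theorem lensMap_semigroup (θ θ' : ℝ) (hθ : θ ∈ Set.Ioo (0 : ℝ) 1)
    (hθ' : θ' ∈ Set.Ioo (0 : ℝ) 1) :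
    Set.MapsTo (lensMap θ) (Metric.ball (0 : ℂ) 1) (Metric.ball (0 : ℂ) 1) ∧
    ∀ z ∈ Metric.ball (0 : ℂ) 1, lensMap θ (lensMap θ' z) = lensMap (θ * θ') z := by
  refine ⟨lens_mapsTo hθ.1 hθ.2, fun z hz => ?_⟩
  have hW := (lens_disk hz).2.2
  have hw := lens_cpow_re hW hθ'.1 hθ'.2
  have him := abs_lt.1 (lens_cpow_im hW hθ'.1 hθ'.2)
  have hpi := Real.pi_pos
  have hcm := Complex.cpow_mul (x := (1 + z) / (1 - z)) (y := (θ' : ℂ)) (θ : ℂ)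
    (by linarith) (by linarith)
  rw [lens_eq (lens_mapsTo hθ'.1 hθ'.2 hz), lens_eq hz (θ * θ'), Complex.ofReal_mul,
    mul_comm (θ : ℂ), hcm]
  have key : (1 + lensMap θ' z) / (1 - lensMap θ' z) = ((1 + z) / (1 - z)) ^ (θ' : ℂ) := by
    rw [lens_eq hz]
    set w := ((1 + z) / (1 - z)) ^ (θ' : ℂ)
    have hne : w + 1 ≠ 0 := lens_ne (by simp; linarith)
    rw [one_add_div hne, one_sub_div hne, div_div_div_cancel_right₀ hne]
    ring
  rw [key]
end
end

section
/- Let d ≥ 1 and let λ_1, …, λ_d : 𝔻 → 𝔻 be holomorphic maps. For a holomorphic function g on 𝔻, let ‖g‖² ∈ [0, ∞] denote the sum of the squared moduli of its Taylor coefficients at 0, and for a holomorphic function F on 𝔻^d let ‖F‖² ∈ [0, ∞] denote the sum over all multi-indices of the squared moduli of its Taylor coefficients at 0. For α ∈ ℕ^d, let φ^α be the function on 𝔻^d given by φ^α(z) = ∏_{k=1}^d λ_k(z_k)^{α_k}. Then ∑_{α ∈ ℕ^d} ‖φ^α‖² = ∏_{k=1}^d (∑_{m=0}^∞ ‖λ_k^m‖²),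 as an identity in [0, ∞]. In particular, if each one-variable composition operator C_{λ_k} is Hilbert–Schmidt on H²(𝔻) then the composition operator of φ = λ_1 ⊗ ⋯ ⊗ λ_d is Hilbert–Schmidt on H²(𝔻^d), with Hilbert–Schmidt norm ∏_{k=1}^d ‖C_{λ_k}‖_{HS}. -/
open scoped ENNReal

noncomputable section

/-- The `m`-th Taylor coefficient at `0` of a function of one complex variable. -/
def taylorCoeff1 (g : ℂ → ℂ) (m : ℕ) : ℂ := iteratedDeriv m g 0 / (m.factorial : ℂ)

/-- The squared Hardy norm of a function of one complex variable: the sum of the squared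
moduli of its Taylor coefficients at `0` (in `[0, ∞]`). -/
def hardyNormSq1 (g : ℂ → ℂ) : ℝ≥0∞ := ∑' m : ℕ, (‖taylorCoeff1 g m‖₊ : ℝ≥0∞) ^ 2

/-- Partial derivative in the `j`-th coordinate direction. -/
def partialDerivAlong {d : ℕ} (j : Fin d) (F : (Fin d → ℂ) → ℂ) : (Fin d → ℂ) → ℂ :=
  fun z => fderiv ℂ F z (Pi.single j 1)

/-- The mixed partial derivative `∂^α F`. -/
def mixedPartial {d : ℕ} (α : Fin d → ℕ) (F : (Fin d → ℂ) → ℂ) : (Fin d → ℂ) → ℂ :=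
  (List.finRange d).foldr (fun j G => (partialDerivAlong j)^[α j] G) F

/-- The Taylor coefficient of `F` at `0` at the multi-index `α`: `∂^α F(0) / α!`. -/
def taylorCoeff {d : ℕ} (F : (Fin d → ℂ) → ℂ) (α : Fin d → ℕ) : ℂ :=
  mixedPartial α F 0 / ∏ j, ((α j).factorial : ℂ)

/-- The squared Hardy norm of a function of `d` complex variables: the sum over all
multi-indices of the squared moduli of its Taylor coefficients at `0` (in `[0, ∞]`). -/
def hardyNormSq {d : ℕ} (F : (Fin d → ℂ) → ℂ) : ℝ≥0∞ :=
  ∑' α : Fin d → ℕ, (‖taylorCoeff F α‖₊ : ℝ≥0∞) ^ 2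

theorem ennreal_tsum_pi_prod : ∀ (d : ℕ) (f : Fin d → ℕ → ℝ≥0∞),
    (∑' α : Fin d → ℕ, ∏ k, f k (α k)) = ∏ k, ∑' m, f k m := by
  intro d
  induction d with
  | zero => intro f; simp
  | succ d ih =>
    intro f
    rw [Fin.prod_univ_succ, ← ih (fun k => f k.succ),
      ← (Fin.consEquiv (fun _ : Fin (d+1) => ℕ)).tsum_eq, ENNReal.tsum_prod']
    simp only [Fin.consEquiv_apply, Fin.prod_univ_succ, Fin.cons_zero, Fin.cons_succ,
      ENNReal.tsum_mul_left, ENNReal.tsum_mul_right]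

theorem iteratedDeriv_diffOn {g : ℂ → ℂ} (hg : DifferentiableOn ℂ g (Metric.ball (0 : ℂ) 1))
    (n : ℕ) : DifferentiableOn ℂ (iteratedDeriv n g) (Metric.ball (0 : ℂ) 1) := by
  induction n with
  | zero => simpa using hg
  | succ n ih => rw [iteratedDeriv_succ]; exact ih.deriv Metric.isOpen_ball

def polyD (d : ℕ) : Set (Fin d → ℂ) := {z | ∀ k, z k ∈ Metric.ball (0 : ℂ) 1}

theorem polyD_open (d : ℕ) : IsOpen (polyD d) := by
  have : polyD d = Set.pi Set.univ (fun _ => Metric.ball (0 : ℂ) 1) := by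
    ext z; simp [polyD]
  rw [this]
  exact isOpen_set_pi Set.finite_univ (fun _ _ => Metric.isOpen_ball)

def tensP {d : ℕ} (g : Fin d → ℂ → ℂ) (β : Fin d → ℕ) : (Fin d → ℂ) → ℂ :=
  fun z => ∏ k, iteratedDeriv (β k) (g k) (z k)

theorem partial_tensP {d : ℕ} (g : Fin d → ℂ → ℂ)
    (hg : ∀ k, DifferentiableOn ℂ (g k) (Metric.ball (0 : ℂ) 1)) (β : Fin d → ℕ) (j : Fin d)
    (F : (Fin d → ℂ) → ℂ) (hF : Set.EqOn F (tensP g β) (polyD d)) :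
    Set.EqOn (partialDerivAlong j F) (tensP g (β + Pi.single j 1)) (polyD d) := by
  intro z hz
  have h1 : F =ᶠ[nhds z] tensP g β := hF.eventuallyEq_of_mem ((polyD_open d).mem_nhds hz)
  have h2 : ∀ k ∈ Finset.univ, HasFDerivAt (fun z : Fin d → ℂ => iteratedDeriv (β k) (g k) (z k))
      ((iteratedDeriv (β k + 1) (g k) (z k)) • (ContinuousLinearMap.proj k : (Fin d → ℂ) →L[ℂ] ℂ)) z := by
    intro k _
    have h := ((iteratedDeriv_diffOn (hg k) (β k)).differentiableAt
      (Metric.isOpen_ball.mem_nhds (hz k))).hasDerivAt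
    rw [← iteratedDeriv_succ] at h
    exact h.comp_hasFDerivAt z (hasFDerivAt_apply (𝕜 := ℂ) k z)
  have h3 := HasFDerivAt.finset_prod h2
  unfold partialDerivAlong
  rw [h1.fderiv_eq]
  unfold tensP
  rw [h3.fderiv]
  simp only [ContinuousLinearMap.sum_apply, ContinuousLinearMap.smul_apply,
    ContinuousLinearMap.proj_apply, smul_eq_mul]
  rw [Finset.sum_eq_single j]
  · rw [← Finset.prod_erase_mul _ _ (Finset.mem_univ j)]
    simp only [Pi.single_eq_same, mul_one, Pi.add_apply]
    congr 1
    refine Finset.prod_congr rfl fun k hk => ?_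
    rw [Pi.single_eq_of_ne (Finset.ne_of_mem_erase hk), add_zero]
  · intro k _ hk
    rw [Pi.single_eq_of_ne hk]; simp
  · simp

theorem iter_tensP {d : ℕ} (g : Fin d → ℂ → ℂ)
    (hg : ∀ k, DifferentiableOn ℂ (g k) (Metric.ball (0 : ℂ) 1)) (β : Fin d → ℕ) (j : Fin d)
    (F : (Fin d → ℂ) → ℂ) (hF : Set.EqOn F (tensP g β) (polyD d)) (n : ℕ) :
    Set.EqOn ((partialDerivAlong j)^[n] F) (tensP g (β + Pi.single j n)) (polyD d) := by
  induction n with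
  | zero => simpa using hF
  | succ n ih =>
    rw [Function.iterate_succ_apply', Pi.single_add, ← add_assoc]
    exact partial_tensP g hg _ j _ ih

theorem fold_tensP {d : ℕ} (g : Fin d → ℂ → ℂ)
    (hg : ∀ k, DifferentiableOn ℂ (g k) (Metric.ball (0 : ℂ) 1)) (α : Fin d → ℕ)
    (l : List (Fin d)) :
    Set.EqOn (l.foldr (fun j G => (partialDerivAlong j)^[α j] G) (tensP g 0))
      (tensP g (l.map (fun j => Pi.single j (α j))).sum) (polyD d) := by
  induction l with
  | nil => intro z _; simp
  | cons j l ih =>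
    rw [List.foldr_cons, List.map_cons, List.sum_cons, add_comm]
    exact iter_tensP g hg _ j _ ih _

theorem taylorCoeff_tensor {d : ℕ} (g : Fin d → ℂ → ℂ)
    (hg : ∀ k, DifferentiableOn ℂ (g k) (Metric.ball (0 : ℂ) 1)) (α : Fin d → ℕ) :
    taylorCoeff (fun z => ∏ k, g k (z k)) α = ∏ k, taylorCoeff1 (g k) (α k) := by
  have h0 : (fun z : Fin d → ℂ => ∏ k, g k (z k)) = tensP g 0 := by
    funext z; simp [tensP]
  have hs : ((List.finRange d).map (fun j => (Pi.single j (α j) : Fin d → ℕ))).sum = α := by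
    rw [← List.ofFn_eq_map, List.sum_ofFn]
    exact Finset.univ_sum_single α
  have h := fold_tensP g hg α (List.finRange d) (x := 0) (by intro k; simp)
  rw [hs] at h
  unfold taylorCoeff mixedPartial taylorCoeff1
  rw [h0, h, Finset.prod_div_distrib]
  rfl

theorem hardyNormSq_tensor {d : ℕ} (g : Fin d → ℂ → ℂ)
    (hg : ∀ k, DifferentiableOn ℂ (g k) (Metric.ball (0 : ℂ) 1)) :
    hardyNormSq (fun z => ∏ k, g k (z k)) = ∏ k, hardyNormSq1 (g k) := by
  unfold hardyNormSq hardyNormSq1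
  rw [← ennreal_tsum_pi_prod]
  refine tsum_congr fun α => ?_
  rw [taylorCoeff_tensor g hg, nnnorm_prod, ENNReal.coe_finset_prod, Finset.prod_pow]

/-- For holomorphic `λ_1, …, λ_d : 𝔻 → 𝔻` and `φ = λ_1 ⊗ ⋯ ⊗ λ_d`, one has
`∑_α ‖φ^α‖² = ∏_k (∑_m ‖λ_k^m‖²)` in `[0, ∞]`. In particular, if each composition
operator `C_{λ_k}` is Hilbert–Schmidt on `H²(𝔻)`, then `C_φ` is Hilbert–Schmidt on
`H²(𝔻^d)` (its squared Hilbert–Schmidt norm `∑_α ‖φ^α‖²` is finite). -/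
theorem hilbert_schmidt_tensor_product (d : ℕ) (hd : 1 ≤ d) (lam : Fin d → ℂ → ℂ)
    (hdiff : ∀ k, DifferentiableOn ℂ (lam k) (Metric.ball (0 : ℂ) 1))
    (hmaps : ∀ k, Set.MapsTo (lam k) (Metric.ball (0 : ℂ) 1) (Metric.ball (0 : ℂ) 1)) :
    (∑' α : Fin d → ℕ, hardyNormSq fun z : Fin d → ℂ => ∏ k, lam k (z k) ^ α k)
        = (∏ k, ∑' m : ℕ, hardyNormSq1 fun z : ℂ => lam k z ^ m) ∧
    ((∀ k, (∑' m : ℕ, hardyNormSq1 fun z : ℂ => lam k z ^ m) ≠ ⊤) →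
      (∑' α : Fin d → ℕ, hardyNormSq fun z : Fin d → ℂ => ∏ k, lam k (z k) ^ α k) ≠ ⊤) := by
  have key : (∑' α : Fin d → ℕ, hardyNormSq fun z : Fin d → ℂ => ∏ k, lam k (z k) ^ α k)
        = (∏ k, ∑' m : ℕ, hardyNormSq1 fun z : ℂ => lam k z ^ m) := by
    rw [← ennreal_tsum_pi_prod]
    refine tsum_congr fun α => ?_
    exact hardyNormSq_tensor (fun k z => lam k z ^ α k) (fun k => (hdiff k).pow (α k))
  refine ⟨key, fun h => ?_⟩
  rw [key]
  exact ENNReal.prod_ne_top fun k _ => h k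
end
end
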